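/- arXiv:2508.17503 — 2 statements merged into one kernel-verified Lean document; each statement's English description precedes it below -/
import Mathlib

section
/- Let A ∈ ℝ^{n×n} be Hurwitz, B ∈ ℝ^{n×1}, C ∈ ℝ^{1×n}. Define T_2 = −C, T_4 = [A^{-1}; −A^{-2}] ∈ ℝ^{2n×n}, T_6 = [A^{-1} B Bᵀ A^{-T}; 0] ∈ ℝ^{2n×n}, T_7 = [[0, A^{-2} B Bᵀ A^{-2T}],[0,0]] ∈ ℝ^{2n×2n}, T_5 = −(T_6 T_4ᵀ + T_4 T_6ᵀ + T_7 + T_7ᵀ), T_3 = T_6 Cᵀ. Let γ ∈ ℝ and suppose there exist S_1, S_2, G_{12} ∈ ℝ^{n×n} with S_1 + S_1ᵀ ⪰ 0, S_2 + S_2ᵀ ⪰ 0, G_{12} + G_{12}ᵀ ⪰ 0, and, with S = [S_1; S_2] and G = [[0, G_{12}],[G_{12}ᵀ, 0]], the symmetric matrix L = [[γ², T_3ᵀ − T_2 Sᵀ], [T_3 − S T_2ᵀ, −S T_4ᵀ − T_4 Sᵀ + T_5 − G]] ∈ ℝ^{(2n+1)×(2n+1)} satisfies L ⪰ 0. Then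 for all p_1 > 0 and p_2 > 0 (for which 𝒜₂ := p_2 I − p_1 A + A² is automatically invertible since A is Hurwitz), f(p_1,p_2) := 2 C 𝒜₂^{-1} (p_1 p_2 B Bᵀ + p_1 A B Bᵀ Aᵀ) 𝒜₂^{-T} Cᵀ ≤ γ². -/
open Matrix

/-- A real square matrix is Hurwitz if every complex eigenvalue has negative real part. -/
def IsHurwitz {k : ℕ} (M : Matrix (Fin k) (Fin k) ℝ) : Prop :=
  ∀ μ ∈ spectrum ℂ (M.map Complex.ofReal), μ.re < 0

theorem IsHurwitz.isUnit_det {k : ℕ} {M : Matrix (Fin k) (Fin k) ℝ} (h : IsHurwitz M) :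
    IsUnit M.det := by
  rw [isUnit_iff_ne_zero]
  intro h0
  have hmem : (0 : ℂ) ∈ spectrum ℂ (M.map Complex.ofReal) := by
    rw [spectrum.zero_mem_iff, Matrix.isUnit_iff_isUnit_det]
    have hdet : (M.map Complex.ofReal).det = ((M.det : ℝ) : ℂ) :=
      (RingHom.map_det Complex.ofRealHom M).symm
    simp [hdet, h0]
  simpa using h 0 hmem

theorem Matrix.PosSemidef.row_mul_mul_transpose_nonneg {m : Type*} [Fintype m]
    {M : Matrix m m ℝ} (hM : M.PosSemidef) (y : Matrix (Fin 1) m ℝ) :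
    0 ≤ (y * M * yᵀ) 0 0 := by
  have h := (hM.mul_mul_conjTranspose_same y).diag_nonneg (i := 0)
  simpa [conjTranspose_eq_transpose_of_trivial] using h

/-- Evaluating the quadratic form of the certificate matrix at the row `[1, -p₁ y, -p₂ y]`, when
`C = y (1 - p₁ K + p₂ K²)`. -/
theorem certificate_quadratic_form {n : ℕ} (K S₁ S₂ G₁₂ : Matrix (Fin n) (Fin n) ℝ)
    (B : Matrix (Fin n) (Fin 1) ℝ) (C y : Matrix (Fin 1) (Fin n) ℝ) (c : Matrix (Fin 1) (Fin 1) ℝ)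
    (p₁ p₂ : ℝ) (hC : C = y - p₁ • (y * K) + p₂ • (y * (K * K)))
    (T₄ T₆ S : Matrix (Fin n ⊕ Fin n) (Fin n) ℝ)
    (T₇ G : Matrix (Fin n ⊕ Fin n) (Fin n ⊕ Fin n) ℝ)
    (hT₄ : T₄ = fromRows K (-(K ^ 2)))
    (hT₆ : T₆ = fromRows (K * B * Bᵀ * Kᵀ) 0)
    (hT₇ : T₇ = fromBlocks 0 ((K ^ 2) * B * Bᵀ * (K ^ 2)ᵀ) 0 0)
    (hS : S = fromRows S₁ S₂) (hG : G = fromBlocks 0 G₁₂ G₁₂ᵀ 0)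
    (v : Matrix (Fin 1) (Fin 1 ⊕ (Fin n ⊕ Fin n)) ℝ)
    (hv : v = fromCols 1 (fromCols (-(p₁ • y)) (-(p₂ • y)))) :
    v * fromBlocks c ((T₆ * Cᵀ)ᵀ - -C * Sᵀ) (T₆ * Cᵀ - S * (-C)ᵀ)
      (-(S * T₄ᵀ) - T₄ * Sᵀ + -(T₆ * T₄ᵀ + T₄ * T₆ᵀ + T₇ + T₇ᵀ) - G) * vᵀ =
    c - (2 * p₁) • (y * K * B * (y * K * B)ᵀ)
      - (2 * p₁ * p₂) • (y * (K * K) * B * (y * (K * K) * B)ᵀ)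
      - p₁ • (y * (S₁ + S₁ᵀ) * yᵀ) - p₂ • (y * (S₂ + S₂ᵀ) * yᵀ)
      - (p₁ * p₂) • (y * (G₁₂ + G₁₂ᵀ) * yᵀ) := by
  obtain ⟨q, hq⟩ : ∃ q, q = fromCols (p₁ • y) (p₂ • y) := ⟨_, rfl⟩
  have hvq : v = fromCols 1 (-q) := by
    rw [hv, hq]; congr 1; ext i (j | j) <;> simp
  have hqT₄ : q * T₄ = y - C := by
    rw [hq, hT₄, fromCols_mul_fromRows, hC, sq]
    simp only [Matrix.smul_mul, Matrix.mul_neg]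
    abel
  have hqT₆ : q * T₆ = p₁ • (y * K * B * (K * B)ᵀ) := by
    rw [hq, hT₆, fromCols_mul_fromRows]
    simp [Matrix.mul_assoc]
  have hqS : q * S = p₁ • (y * S₁) + p₂ • (y * S₂) := by
    rw [hq, hS, fromCols_mul_fromRows]
    simp
  have hqT₇ : q * T₇ * qᵀ = (p₁ * p₂) • (y * (K * K) * B * (y * (K * K) * B)ᵀ) := by
    rw [hq, hT₇, transpose_fromCols, fromCols_mul_fromBlocks, fromCols_mul_fromRows]
    simp [Matrix.mul_assoc, sq, smul_smul, mul_comm]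
  have hqG : q * G * qᵀ = (p₁ * p₂) • (y * (G₁₂ + G₁₂ᵀ) * yᵀ) := by
    rw [hq, hG, transpose_fromCols, fromCols_mul_fromBlocks, fromCols_mul_fromRows]
    simp only [Matrix.mul_assoc, smul_smul, Matrix.mul_add, Matrix.add_mul, Matrix.smul_mul,
      transpose_smul, Matrix.mul_smul, Matrix.mul_zero, zero_add, add_zero]
    module
  have hT₄q : T₄ᵀ * qᵀ = yᵀ - Cᵀ := by rw [← transpose_mul, hqT₄, transpose_sub]
  have hT₇q : q * T₇ᵀ * qᵀ = (p₁ * p₂) • (y * (K * K) * B * (y * (K * K) * B)ᵀ) := by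
    have := congrArg transpose hqT₇
    simpa [Matrix.mul_assoc] using this
  have hexp : v * fromBlocks c ((T₆ * Cᵀ)ᵀ - -C * Sᵀ) (T₆ * Cᵀ - S * (-C)ᵀ)
      (-(S * T₄ᵀ) - T₄ * Sᵀ + -(T₆ * T₄ᵀ + T₄ * T₆ᵀ + T₇ + T₇ᵀ) - G) * vᵀ =
      c - C * (q * T₆)ᵀ - C * (q * S)ᵀ - (q * T₆) * Cᵀ - (q * S) * Cᵀ
      - (q * S) * (T₄ᵀ * qᵀ) - (q * T₄) * (q * S)ᵀ - (q * T₆) * (T₄ᵀ * qᵀ)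
      - (q * T₄) * (q * T₆)ᵀ - q * T₇ * qᵀ - q * T₇ᵀ * qᵀ - q * G * qᵀ := by
    rw [hvq, transpose_fromCols, fromCols_mul_fromBlocks, fromCols_mul_fromRows]
    simp only [transpose_mul, transpose_neg, transpose_transpose, transpose_one, Matrix.one_mul,
      Matrix.mul_one, Matrix.mul_add, Matrix.add_mul, Matrix.mul_sub, Matrix.sub_mul,
      Matrix.mul_neg, Matrix.neg_mul, Matrix.mul_assoc]
    abel
  rw [hexp, hqT₄, hT₄q, hqT₆, hqS, hqT₇, hT₇q, hqG]
  simp only [transpose_mul, transpose_add, transpose_smul, transpose_transpose,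
    Matrix.mul_add, Matrix.add_mul, Matrix.mul_sub, Matrix.sub_mul, Matrix.smul_mul,
    Matrix.mul_smul, Matrix.mul_assoc, smul_add]
  module

theorem stmt14 {n : ℕ}
    (A : Matrix (Fin n) (Fin n) ℝ) (B : Matrix (Fin n) (Fin 1) ℝ) (C : Matrix (Fin 1) (Fin n) ℝ)
    (hA : IsHurwitz A)
    (T₂ : Matrix (Fin 1) (Fin n) ℝ) (hT₂ : T₂ = -C)
    (T₄ : Matrix (Fin n ⊕ Fin n) (Fin n) ℝ)
    (hT₄ : T₄ = Matrix.fromRows A⁻¹ (-(A⁻¹ ^ 2)))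
    (T₆ : Matrix (Fin n ⊕ Fin n) (Fin n) ℝ)
    (hT₆ : T₆ = Matrix.fromRows (A⁻¹ * B * Bᵀ * (A⁻¹)ᵀ) 0)
    (T₇ : Matrix (Fin n ⊕ Fin n) (Fin n ⊕ Fin n) ℝ)
    (hT₇ : T₇ = Matrix.fromBlocks 0 ((A⁻¹ ^ 2) * B * Bᵀ * ((A⁻¹ ^ 2))ᵀ) 0 0)
    (T₅ : Matrix (Fin n ⊕ Fin n) (Fin n ⊕ Fin n) ℝ)
    (hT₅ : T₅ = -(T₆ * T₄ᵀ + T₄ * T₆ᵀ + T₇ + T₇ᵀ))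
    (T₃ : Matrix (Fin n ⊕ Fin n) (Fin 1) ℝ) (hT₃ : T₃ = T₆ * Cᵀ)
    (γ : ℝ)
    (S₁ S₂ G₁₂ : Matrix (Fin n) (Fin n) ℝ)
    (hS₁ : (S₁ + S₁ᵀ).PosSemidef)
    (hS₂ : (S₂ + S₂ᵀ).PosSemidef)
    (hG₁₂ : (G₁₂ + G₁₂ᵀ).PosSemidef)
    (S : Matrix (Fin n ⊕ Fin n) (Fin n) ℝ) (hS : S = Matrix.fromRows S₁ S₂)
    (G : Matrix (Fin n ⊕ Fin n) (Fin n ⊕ Fin n) ℝ)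
    (hG : G = Matrix.fromBlocks 0 G₁₂ G₁₂ᵀ 0)
    (L : Matrix (Fin 1 ⊕ (Fin n ⊕ Fin n)) (Fin 1 ⊕ (Fin n ⊕ Fin n)) ℝ)
    (hL : L = Matrix.fromBlocks !![γ ^ 2] (T₃ᵀ - T₂ * Sᵀ) (T₃ - S * T₂ᵀ)
      (-(S * T₄ᵀ) - T₄ * Sᵀ + T₅ - G))
    (hLpsd : L.PosSemidef) :
    ∀ p₁ p₂ : ℝ, 0 < p₁ → 0 < p₂ →
      2 * (((C * (p₂ • (1 : Matrix (Fin n) (Fin n) ℝ) - p₁ • A + A ^ 2)⁻¹ *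
            ((p₁ * p₂) • (B * Bᵀ) + p₁ • (A * B * Bᵀ * Aᵀ)) *
            (((p₂ • (1 : Matrix (Fin n) (Fin n) ℝ) - p₁ • A + A ^ 2) :
              Matrix (Fin n) (Fin n) ℝ)⁻¹)ᵀ * Cᵀ : Matrix (Fin 1) (Fin 1) ℝ)) 0 0)
        ≤ γ ^ 2 := by
  intro p₁ p₂ hp₁ hp₂
  obtain ⟨P, hP⟩ : ∃ P, P = p₂ • (1 : Matrix (Fin n) (Fin n) ℝ) - p₁ • A + A ^ 2 := ⟨_, rfl⟩
  rw [← hP]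
  have hAu := hA.isUnit_det
  by_cases hPu : IsUnit P.det
  swap
  · simpa [nonsing_inv_apply_not_isUnit P hPu] using sq_nonneg γ
  obtain ⟨y, hy⟩ : ∃ y, y = C * P⁻¹ * (A * A) := ⟨_, rfl⟩
  have hyK : y * A⁻¹ = C * P⁻¹ * A := by
    rw [hy, ← Matrix.mul_assoc, mul_nonsing_inv_cancel_right _ _ hAu]
  have hyKK : y * (A⁻¹ * A⁻¹) = C * P⁻¹ := by
    rw [← Matrix.mul_assoc, hyK, mul_nonsing_inv_cancel_right _ _ hAu]
  have hC : C = y - p₁ • (y * A⁻¹) + p₂ • (y * (A⁻¹ * A⁻¹)) := by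
    have h : C = C * P⁻¹ * P := (nonsing_inv_mul_cancel_right _ _ hPu).symm
    rw [hyK, hyKK, hy]
    nth_rw 1 [h]
    nth_rw 2 [hP]
    simp only [Matrix.mul_add, Matrix.mul_sub, Matrix.mul_smul, Matrix.mul_one, sq]
    abel
  have hquad := certificate_quadratic_form A⁻¹ S₁ S₂ G₁₂ B C y !![γ ^ 2] p₁ p₂ hC T₄ T₆ S T₇ G
    hT₄ hT₆ hT₇ hS hG _ rfl
  rw [← hT₂, ← hT₃, ← hT₅, ← hL, hyK, hyKK] at hquad
  have hpos := hLpsd.row_mul_mul_transpose_nonneg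
    (fromCols 1 (fromCols (-(p₁ • y)) (-(p₂ • y))))
  rw [hquad] at hpos
  have h₁ := mul_nonneg hp₁.le (hS₁.row_mul_mul_transpose_nonneg y)
  have h₂ := mul_nonneg hp₂.le (hS₂.row_mul_mul_transpose_nonneg y)
  have h₃ := mul_nonneg (mul_nonneg hp₁.le hp₂.le) (hG₁₂.row_mul_mul_transpose_nonneg y)
  have hgoal : C * P⁻¹ * ((p₁ * p₂) • (B * Bᵀ) + p₁ • (A * B * Bᵀ * Aᵀ)) * (P⁻¹)ᵀ * Cᵀ =
      (p₁ * p₂) • (C * P⁻¹ * B * (C * P⁻¹ * B)ᵀ) +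
        p₁ • (C * P⁻¹ * A * B * (C * P⁻¹ * A * B)ᵀ) := by
    simp only [transpose_mul, Matrix.mul_add, Matrix.add_mul, Matrix.smul_mul,
      Matrix.mul_smul, Matrix.mul_assoc]
  rw [hgoal]
  simp only [Matrix.sub_apply, Matrix.add_apply, Matrix.smul_apply, smul_eq_mul, of_apply,
    cons_val', cons_val_fin_one] at hpos ⊢
  linarith
end

section
/- Let A ∈ ℝ^{n×n} be Hurwitz, B ∈ ℝ^{n×1}, C ∈ ℝ^{1×n}. Assume A has no real eigenvalues and the pair (A^{-T}, Cᵀ) is controllable, i.e. [Cᵀ, A^{-T}Cᵀ, …, (A^{-T})^{n−1}Cᵀ] has rank n. Define T_2 = −C, T_4 = A^{-1}, T_6 = A^{-1} B Bᵀ A^{-T}, T_5 = −(T_6 T_4ᵀ + T_4 T_6ᵀ), T_3 = T_6 Cᵀ, and f(p_1) = 2 C (p_1 I − A)^{-1} (p_1 B Bᵀ) (p_1 I − A)^{-T} Cᵀ for p_1 > 0. Then for every γ ∈ ℝ the following are equivalent: (i) there exists S ∈ ℝ^{n×n} with S + Sᵀ ⪰ 0 such that L = [[γ², T_3ᵀ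 − T_2 Sᵀ], [T_3 − S T_2ᵀ, −S T_4ᵀ − T_4 Sᵀ + T_5]] ⪰ 0; (ii) f(p_1) ≤ γ² for all p_1 > 0. Consequently, the minimal value of γ² over all feasible (γ, S) equals the supremum of f(p_1) over p_1 > 0, i.e. the semidefinite relaxation is exact for first-order (m = 1) H₂-optimal model reduction. -/
open Matrix

/-- `f(p₁) = 2 C (p₁ I − A)⁻¹ (p₁ B Bᵀ) (p₁ I − A)⁻ᵀ Cᵀ`, the squared H₂ norm of the
first-order interpolatory reduced model at interpolation point `p₁`. -/
noncomputable def fOne {n : ℕ} (A : Matrix (Fin n) (Fin n) ℝ) (B : Matrix (Fin n) (Fin 1) ℝ)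
    (C : Matrix (Fin 1) (Fin n) ℝ) (p₁ : ℝ) : ℝ :=
  2 * ((C * (p₁ • (1 : Matrix (Fin n) (Fin n) ℝ) - A)⁻¹ * (p₁ • (B * Bᵀ)) *
    ((p₁ • (1 : Matrix (Fin n) (Fin n) ℝ) - A)⁻¹)ᵀ * Cᵀ) 0 0)

/-- The LMI matrix `L` of the semidefinite relaxation for `m = 1`. -/
noncomputable def LOne {n : ℕ} (A : Matrix (Fin n) (Fin n) ℝ) (B : Matrix (Fin n) (Fin 1) ℝ)
    (C : Matrix (Fin 1) (Fin n) ℝ) (γ : ℝ) (S : Matrix (Fin n) (Fin n) ℝ) :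
    Matrix (Fin 1 ⊕ Fin n) (Fin 1 ⊕ Fin n) ℝ :=
  let T₂ : Matrix (Fin 1) (Fin n) ℝ := -C
  let T₄ : Matrix (Fin n) (Fin n) ℝ := A⁻¹
  let T₆ : Matrix (Fin n) (Fin n) ℝ := A⁻¹ * B * Bᵀ * (A⁻¹)ᵀ
  let T₅ : Matrix (Fin n) (Fin n) ℝ := -(T₆ * T₄ᵀ + T₄ * T₆ᵀ)
  let T₃ : Matrix (Fin n) (Fin 1) ℝ := T₆ * Cᵀ
  Matrix.fromBlocks !![γ ^ 2] (T₃ᵀ - T₂ * Sᵀ) (T₃ - S * T₂ᵀ) (-(S * T₄ᵀ) - T₄ * Sᵀ + T₅)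

lemma Matrix.PosSemidef.exists_orthogonal_diagonal {ι : Type*} [Fintype ι] [DecidableEq ι]
    {M : Matrix ι ι ℝ} (hM : M.PosSemidef) :
    ∃ (U : Matrix ι ι ℝ) (d : ι → ℝ), U * Uᵀ = 1 ∧ M = U * diagonal d * Uᵀ ∧ ∀ i, 0 ≤ d i := by
  refine ⟨hM.1.eigenvectorUnitary, hM.1.eigenvalues, ?_, ?_, hM.eigenvalues_nonneg⟩
  · have := Unitary.mul_star_self_of_mem hM.1.eigenvectorUnitary.2
    simpa [star_eq_conjTranspose] using this
  · have := hM.1.spectral_theorem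
    rw [Unitary.conjStarAlgAut_apply] at this
    simpa [star_eq_conjTranspose, Function.comp_def] using this

/-- Simultaneous diagonalization by congruence. -/
lemma Matrix.PosDef.exists_simultaneous_diagonal {ι : Type*} [Fintype ι] [DecidableEq ι]
    {V Y : Matrix ι ι ℝ} (hV : V.PosDef) (hY : Y.PosSemidef) :
    ∃ (R : Matrix ι ι ℝ) (d : ι → ℝ), IsUnit R ∧ V = R * Rᵀ ∧ Y = R * diagonal d * Rᵀ ∧
      ∀ i, 0 ≤ d i := by
  obtain ⟨U, e, -, hVe, he⟩ := hV.posSemidef.exists_orthogonal_diagonal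
  set P := U * diagonal fun i => √(e i) with hP
  have hVP : V = P * Pᵀ := by
    rw [hVe, hP, transpose_mul, diagonal_transpose, ← Matrix.mul_assoc,
      Matrix.mul_assoc U (diagonal _) (diagonal _),
      diagonal_mul_diagonal]
    simp only [Real.mul_self_sqrt (he _)]
  clear_value P
  have hPu : IsUnit P := by
    have := hV.isUnit
    rw [hVP] at this
    exact isUnit_of_mul_isUnit_left this
  have hPd : IsUnit P.det := (isUnit_iff_isUnit_det _).1 hPu
  have hQ : (P⁻¹ * Y * P⁻¹ᵀ).PosSemidef := by
    simpa using hY.mul_mul_conjTranspose_same P⁻¹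
  obtain ⟨O, d, hO, hQd, hd⟩ := hQ.exists_orthogonal_diagonal
  refine ⟨P * O, d, hPu.mul (IsUnit.of_mul_eq_one _ hO), ?_, ?_, hd⟩
  · rw [transpose_mul, Matrix.mul_assoc, ← Matrix.mul_assoc O, hO, Matrix.one_mul, hVP]
  · calc Y = P * (P⁻¹ * Y * P⁻¹ᵀ) * Pᵀ := by
          rw [← Matrix.mul_assoc, ← Matrix.mul_assoc, mul_nonsing_inv _ hPd, Matrix.one_mul,
            Matrix.mul_assoc, ← transpose_mul, mul_nonsing_inv _ hPd, transpose_one, Matrix.mul_one]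
      _ = _ := by rw [hQd, transpose_mul P O]; simp only [Matrix.mul_assoc]

/-- Weak duality for the semidefinite relaxation, at a positive definite point. -/
lemma dual_value_nonneg_of_posDef {ι : Type*} [Fintype ι] [DecidableEq ι]
    {G V Y : Matrix ι ι ℝ} {b c v : ι → ℝ} {z g : ℝ}
    (hg : ∀ l, 0 ≤ l → ∀ (x : ι → ℝ) (r : ℝ), G *ᵥ x - r • c = l • x →
      2 * l * (b ⬝ᵥ x) ^ 2 ≤ g * r ^ 2) (hg0 : 0 ≤ g)
    (hV : V.PosDef) (hY : Y.PosSemidef)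
    (hz : ∀ y, 0 ≤ z + 2 * (y ⬝ᵥ v) + y ⬝ᵥ V *ᵥ y)
    (h : Y = G * V - vecMulVec c v) :
    0 ≤ g * z - 2 * (b ⬝ᵥ Y *ᵥ b) := by
  obtain ⟨R, d, hR, hVR, hYR, hd⟩ := hV.exists_simultaneous_diagonal hY
  have hRd : IsUnit R.det := (isUnit_iff_isUnit_det _).1 hR
  set r := R⁻¹ *ᵥ v with hr
  have hv : R *ᵥ r = v := by rw [hr, mulVec_mulVec, mul_nonsing_inv _ hRd, one_mulVec]
  have hzr : r ⬝ᵥ r ≤ z := by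
    have := hz (-(R⁻¹ᵀ *ᵥ r))
    have e1 : (R⁻¹ᵀ *ᵥ r) ⬝ᵥ v = r ⬝ᵥ r := by
      rw [mulVec_transpose, ← dotProduct_mulVec, ← hr]
    have e2 : V *ᵥ (R⁻¹ᵀ *ᵥ r) = v := by
      rw [hVR, mulVec_mulVec, Matrix.mul_assoc, ← transpose_mul, nonsing_inv_mul _ hRd,
        transpose_one, Matrix.mul_one, hv]
    rw [mulVec_neg, e2, neg_dotProduct, neg_dotProduct, dotProduct_neg, e1] at this
    linarith
  have hcol : G * R - vecMulVec c r = R * diagonal d := by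
    have h1 : (G * R - vecMulVec c r) * Rᵀ = R * diagonal d * Rᵀ := by
      rw [← hYR, h, sub_mul, hVR, ← Matrix.mul_assoc, vecMulVec_mul, vecMul_transpose, hv]
    have hRt : IsUnit Rᵀ.det := by rwa [det_transpose]
    calc _ = (G * R - vecMulVec c r) * Rᵀ * Rᵀ⁻¹ := by
            rw [Matrix.mul_assoc, mul_nonsing_inv _ hRt, Matrix.mul_one]
      _ = _ := by rw [h1, Matrix.mul_assoc, mul_nonsing_inv _ hRt, Matrix.mul_one]
  have hb : b ⬝ᵥ Y *ᵥ b = ∑ i, d i * (b ⬝ᵥ R.col i) ^ 2 := by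
    rw [hYR, Matrix.mul_assoc, ← mulVec_mulVec, dotProduct_mulVec, ← mulVec_mulVec,
      mulVec_transpose, dotProduct]
    refine Finset.sum_congr rfl fun i _ => ?_
    rw [mulVec_diagonal]
    simp only [vecMul, col_def, transpose_apply, dotProduct]
    ring
  have hi : ∀ i, 2 * (d i * (b ⬝ᵥ R.col i) ^ 2) ≤ g * (r i * r i) := by
    intro i
    have := hg (d i) (hd i) (R.col i) (r i) (by
      ext j
      have := congrFun (congrFun hcol j) i
      rw [Matrix.sub_apply, vecMulVec_apply, mul_diagonal, Matrix.mul_apply] at this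
      simp only [Pi.sub_apply, Pi.smul_apply, smul_eq_mul, mulVec, dotProduct, col_apply]
      linarith)
    linarith
  have hs : 2 * (b ⬝ᵥ Y *ᵥ b) ≤ g * (r ⬝ᵥ r) := by
    rw [hb, dotProduct, Finset.mul_sum, Finset.mul_sum]
    exact Finset.sum_le_sum fun i _ => hi i
  have := mul_le_mul_of_nonneg_left hzr hg0
  linarith

lemma exists_nonneg_mul_add_of_homogeneous {E : Type*} [NormedAddCommGroup E] [NormedSpace ℝ E]
    [FiniteDimensional ℝ E] {q₀ q : E → ℝ} (h₀ : Continuous q₀) (h : Continuous q)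
    (hh₀ : ∀ (t : ℝ) x, q₀ (t • x) = t ^ 2 * q₀ x) (hh : ∀ (t : ℝ) x, q (t • x) = t ^ 2 * q x)
    (hpos : ∀ x, x ≠ 0 → 0 < q₀ x) :
    ∃ T : ℝ, ∀ t, T ≤ t → ∀ x, 0 ≤ t * q₀ x + q x := by
  have hc : ContinuousOn (fun x => -(q x / q₀ x)) (Metric.sphere (0 : E) 1) := by
    refine (h.continuousOn.div h₀.continuousOn fun x hx => (hpos x ?_).ne').neg
    rintro rfl
    simp at hx
  obtain ⟨T, hT⟩ := (isCompact_sphere (0 : E) 1).bddAbove_image hc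
  refine ⟨T, fun t ht x => ?_⟩
  rcases eq_or_ne x 0 with rfl | hx
  · have e₀ := hh₀ 0 0
    have e := hh 0 0
    rw [smul_zero, zero_pow two_ne_zero, zero_mul] at e₀ e
    rw [e₀, e, mul_zero, add_zero]
  · have hn : ‖x‖ ≠ 0 := norm_ne_zero_iff.2 hx
    set u := ‖x‖⁻¹ • x with hu
    have hu1 : u ∈ Metric.sphere (0 : E) 1 := by simp [hu, norm_smul, hn]
    have hu0 : u ≠ 0 := by simp [hu, hx]
    have h1 := (hT ⟨u, hu1, rfl⟩).trans ht
    have hp := hpos u hu0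
    have h2 : 0 ≤ t * q₀ u + q u := by
      rw [neg_le, le_div_iff₀ hp] at h1
      linarith
    have hxu : x = ‖x‖ • u := by rw [hu, smul_smul, mul_inv_cancel₀ hn, one_smul]
    rw [hxu, hh₀, hh]
    nlinarith [mul_nonneg (sq_nonneg ‖x‖) h2]

section Duality

variable {ι : Type*} [Fintype ι]

/-- The dual variables `(z, v, V, Y)`, standing for the pair of matrices `[[z, vᵀ], [v, V]]`
and `Y`. -/
abbrev DualSpace (ι : Type*) : Type _ := ℝ × (ι → ℝ) × Matrix ι ι ℝ × Matrix ι ι ℝ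

/-- The quadratic form of `[[z, vᵀ], [v, V]]` at `(w, y)`. -/
def borderedForm (w : ℝ) (y : ι → ℝ) : DualSpace ι →ₗ[ℝ] ℝ where
  toFun x := w ^ 2 * x.1 + 2 * w * (y ⬝ᵥ x.2.1) + y ⬝ᵥ x.2.2.1 *ᵥ y
  map_add' a b := by
    simp only [Prod.fst_add, Prod.snd_add, dotProduct_add, add_mulVec]; ring
  map_smul' a b := by
    simp only [Prod.smul_fst, Prod.smul_snd, dotProduct_smul, smul_mulVec, smul_eq_mul,
      RingHom.id_apply]; ring

/-- The quadratic form of `Y` at `y`. -/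
def slackForm (y : ι → ℝ) : DualSpace ι →ₗ[ℝ] ℝ where
  toFun x := y ⬝ᵥ x.2.2.2 *ᵥ y
  map_add' a b := by
    simp only [Prod.snd_add, dotProduct_add, add_mulVec]
  map_smul' a b := by
    simp only [Prod.smul_snd, dotProduct_smul, smul_mulVec, smul_eq_mul, RingHom.id_apply]

/-- The cone of dual variables with nonnegative quadratic forms. -/
def dualCone (ι : Type*) [Fintype ι] : PointedCone ℝ (DualSpace ι) where
  carrier := {x | (∀ w y, 0 ≤ borderedForm w y x) ∧ ∀ y, 0 ≤ slackForm y x}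
  add_mem' {a b} ha hb := by
    refine ⟨fun w y => ?_, fun y => ?_⟩
    · rw [map_add]; exact add_nonneg (ha.1 w y) (hb.1 w y)
    · rw [map_add]; exact add_nonneg (ha.2 y) (hb.2 y)
  zero_mem' := by simp
  smul_mem' t a ha := by
    refine ⟨fun w y => ?_, fun y => ?_⟩
    · rw [Nonneg.mk_smul t.1 t.2, map_smul]; exact mul_nonneg t.2 (ha.1 w y)
    · rw [Nonneg.mk_smul t.1 t.2, map_smul]; exact mul_nonneg t.2 (ha.2 y)

/-- The dual constraint `Y = G V - c vᵀ` together with the symmetry of `V` and `Y`. -/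
def dualConstraint (G : Matrix ι ι ℝ) (c : ι → ℝ) :
    DualSpace ι →ₗ[ℝ] Matrix ι ι ℝ × Matrix ι ι ℝ × Matrix ι ι ℝ where
  toFun x := (x.2.2.2 - (G * x.2.2.1 - vecMulVec c x.2.1), x.2.2.1ᵀ - x.2.2.1,
    x.2.2.2ᵀ - x.2.2.2)
  map_add' a b := by
    simp only [Prod.snd_add, Prod.fst_add, Matrix.mul_add, vecMulVec_add, transpose_add,
      Prod.mk_add_mk]
    refine Prod.ext ?_ (Prod.ext ?_ ?_) <;> simp only <;> abel
  map_smul' a b := by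
    simp only [Prod.smul_snd, Prod.smul_fst, Matrix.mul_smul, vecMulVec_smul, transpose_smul,
      Prod.smul_mk, smul_sub, RingHom.id_apply]

/-- The dual objective `g z - 2 bᵀ Y b`. -/
def dualCost (b : ι → ℝ) (g : ℝ) : DualSpace ι →ₗ[ℝ] ℝ where
  toFun x := g * x.1 - 2 * (b ⬝ᵥ x.2.2.2 *ᵥ b)
  map_add' a b := by
    simp only [Prod.snd_add, Prod.fst_add, dotProduct_add, add_mulVec]; ring
  map_smul' a b := by
    simp only [Prod.smul_fst, Prod.smul_snd, dotProduct_smul, smul_mulVec, smul_eq_mul,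
      RingHom.id_apply]; ring

/-- The dual variable `((w, y) (w, y)ᵀ, u uᵀ)` scaled by `l` in the second component. -/
def rankOneDual (w : ℝ) (y : ι → ℝ) (l : ℝ) (u : ι → ℝ) : DualSpace ι :=
  (w ^ 2, w • y, vecMulVec y y, l • vecMulVec u u)

lemma dotProduct_vecMulVec_mulVec (y a b x : ι → ℝ) :
    y ⬝ᵥ vecMulVec a b *ᵥ x = (y ⬝ᵥ a) * (b ⬝ᵥ x) := by
  rw [vecMulVec_mulVec, dotProduct_smul]
  simp

lemma borderedForm_rankOneDual (w' : ℝ) (y' : ι → ℝ) (w : ℝ) (y : ι → ℝ) (l : ℝ) (u : ι → ℝ) :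
    borderedForm w' y' (rankOneDual w y l u) = (w' * w + y' ⬝ᵥ y) ^ 2 := by
  simp only [borderedForm, rankOneDual, LinearMap.coe_mk, AddHom.coe_mk,
    dotProduct_vecMulVec_mulVec, dotProduct_smul, smul_eq_mul, dotProduct_comm y y']
  ring

lemma slackForm_rankOneDual (y' : ι → ℝ) (w : ℝ) (y : ι → ℝ) (l : ℝ) (u : ι → ℝ) :
    slackForm y' (rankOneDual w y l u) = l * (y' ⬝ᵥ u) ^ 2 := by
  simp only [slackForm, rankOneDual, LinearMap.coe_mk, AddHom.coe_mk, smul_mulVec,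
    dotProduct_vecMulVec_mulVec, dotProduct_smul, smul_eq_mul, dotProduct_comm u y']
  ring

lemma rankOneDual_mem_dualCone (w : ℝ) (y : ι → ℝ) {l : ℝ} (hl : 0 ≤ l) (u : ι → ℝ) :
    rankOneDual w y l u ∈ dualCone ι := by
  refine ⟨fun w' y' => ?_, fun y' => ?_⟩
  · rw [borderedForm_rankOneDual]; positivity
  · rw [slackForm_rankOneDual]; positivity

/-- Strict feasibility of the dual problem. -/
lemma exists_strictly_feasible [DecidableEq ι] {G : Matrix ι ι ℝ} {c : ι → ℝ}
    (hspan : ∀ (a : ℝ) (y : ι → ℝ),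
      (∀ l : ℝ, 0 < l → ∀ v : ι → ℝ, G *ᵥ v - c = l • v → a + y ⬝ᵥ v = 0) → a = 0 ∧ y = 0) :
    ∃ x₀ : DualSpace ι, dualConstraint G c x₀ = 0 ∧
      (∀ w y, (w, y) ≠ 0 → 0 < borderedForm w y x₀) ∧ ∀ y, y ≠ 0 → 0 < slackForm y x₀ := by
  set s : Set (ℝ × (ι → ℝ)) := {p | p.1 = 1 ∧ ∃ l : ℝ, 0 < l ∧ G *ᵥ p.2 - c = l • p.2} with hs
  have hker : ∀ (a : ℝ) (y : ι → ℝ), (∀ p ∈ s, a * p.1 + y ⬝ᵥ p.2 = 0) → (a, y) = 0 := by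
    intro a y h
    obtain ⟨rfl, rfl⟩ := hspan a y fun l hl v hv => by
      simpa using h (1, v) ⟨rfl, l, hl, hv⟩
    rfl
  have htop : Submodule.span ℝ s = ⊤ := by
    by_contra hne
    obtain ⟨f, hf0, hf⟩ := Submodule.exists_le_ker_of_lt_top _ (lt_top_iff_ne_top.2 hne)
    have hfe : ∀ p : ℝ × (ι → ℝ),
        f p = f (1, 0) * p.1 + (fun i => f (0, Pi.single i 1)) ⬝ᵥ p.2 := by
      rintro ⟨a, y⟩
      have hy : y = ∑ i, y i • (Pi.single i 1 : ι → ℝ) := by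
        simpa using (pi_eq_sum_univ' y)
      have : ((a, y) : ℝ × (ι → ℝ)) = a • (1, 0) + ∑ i, y i • (0, Pi.single i 1) := by
        refine Prod.ext ?_ ?_
        · simp [Prod.fst_sum]
        · simpa [Prod.snd_sum] using hy
      rw [this, map_add, map_smul, map_sum]
      simp only [map_smul, smul_eq_mul, dotProduct]
      rw [← this]
      simp only [mul_comm]
    have := hker _ _ fun p hp => (hfe p).symm.trans (hf (Submodule.subset_span hp))
    rw [Prod.mk_eq_zero] at this
    refine hf0 (LinearMap.ext fun p => ?_)
    rw [hfe, this.1, this.2]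
    simp
  obtain ⟨t, hts, ht⟩ := (Submodule.fg_span_iff_fg_span_finset_subset s).1
    (htop ▸ Module.Finite.fg_top)
  have hker' : ∀ (a : ℝ) (y : ι → ℝ), (∀ p ∈ t, a * p.1 + y ⬝ᵥ p.2 = 0) → (a, y) = 0 := by
    intro a y h
    let f : ℝ × (ι → ℝ) →ₗ[ℝ] ℝ :=
      { toFun := fun p => a * p.1 + y ⬝ᵥ p.2
        map_add' := fun p q => by simp only [Prod.fst_add, Prod.snd_add, dotProduct_add]; ring
        map_smul' := fun r p => by
          simp only [Prod.smul_fst, Prod.smul_snd, dotProduct_smul, smul_eq_mul,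
            RingHom.id_apply]; ring }
    have hle : Submodule.span ℝ s ≤ LinearMap.ker f := by
      rw [ht, Submodule.span_le]; exact fun p hp => h p hp
    exact hker a y fun p hp => hle (Submodule.subset_span hp)
  have hl : ∀ p : ℝ × (ι → ℝ), ∃ l : ℝ, p ∈ t → p.1 = 1 ∧ 0 < l ∧ G *ᵥ p.2 - c = l • p.2 := by
    intro p
    by_cases hp : p ∈ t
    · obtain ⟨h1, l, h2⟩ := hts hp
      exact ⟨l, fun _ => ⟨h1, h2⟩⟩
    · exact ⟨0, fun h => absurd h hp⟩
  choose l hl using hl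
  refine ⟨∑ p ∈ t, rankOneDual 1 p.2 (l p) p.2, ?_, fun w y hwy => ?_, fun y hy => ?_⟩
  · rw [map_sum]
    refine Finset.sum_eq_zero fun p hp => ?_
    obtain ⟨-, -, h⟩ := hl p hp
    simp only [dualConstraint, rankOneDual, LinearMap.coe_mk, AddHom.coe_mk, one_smul,
      mul_vecMulVec, transpose_smul, transpose_vecMulVec, sub_self]
    rw [← sub_vecMulVec, h, smul_vecMulVec, sub_self]
    rfl
  · rw [map_sum]
    simp only [borderedForm_rankOneDual]
    refine lt_of_le_of_ne (Finset.sum_nonneg fun p _ => sq_nonneg _) fun h0 => hwy ?_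
    refine hker' w y fun p hp => ?_
    have := (Finset.sum_eq_zero_iff_of_nonneg fun p _ => sq_nonneg _).1 h0.symm p hp
    rw [(hl p hp).1]
    exact pow_eq_zero_iff two_ne_zero |>.1 this
  · rw [map_sum]
    simp only [slackForm_rankOneDual]
    have hnn : ∀ p ∈ t, 0 ≤ l p * (y ⬝ᵥ p.2) ^ 2 := fun p hp =>
      mul_nonneg (hl p hp).2.1.le (sq_nonneg _)
    refine lt_of_le_of_ne (Finset.sum_nonneg hnn) fun h0 => hy ?_
    have := hker' 0 y fun p hp => by
      have := (Finset.sum_eq_zero_iff_of_nonneg hnn).1 h0.symm p hp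
      rw [mul_eq_zero, or_iff_right (hl p hp).2.1.ne', pow_eq_zero_iff two_ne_zero] at this
      rw [zero_mul, zero_add, this]
    exact (Prod.mk_eq_zero.1 this).2

lemma exists_dominating {x₀ : DualSpace ι}
    (h₁ : ∀ w y, (w, y) ≠ 0 → 0 < borderedForm w y x₀) (h₂ : ∀ y, y ≠ 0 → 0 < slackForm y x₀)
    (x : DualSpace ι) : ∃ t : ℝ, t • x₀ + x ∈ dualCone ι := by
  have hc₁ : ∀ x : DualSpace ι, Continuous fun p : ℝ × (ι → ℝ) => borderedForm p.1 p.2 x := by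
    intro x
    simp only [borderedForm, LinearMap.coe_mk, AddHom.coe_mk, dotProduct, mulVec]
    fun_prop
  have hc₂ : ∀ x : DualSpace ι, Continuous fun y : ι → ℝ => slackForm y x := by
    intro x
    simp only [slackForm, LinearMap.coe_mk, AddHom.coe_mk, dotProduct, mulVec]
    fun_prop
  have hh₁ : ∀ (x : DualSpace ι) (t : ℝ) (p : ℝ × (ι → ℝ)),
      borderedForm (t • p).1 (t • p).2 x = t ^ 2 * borderedForm p.1 p.2 x := by
    intro x t p
    simp only [borderedForm, LinearMap.coe_mk, AddHom.coe_mk, Prod.smul_fst, Prod.smul_snd,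
      smul_dotProduct, mulVec_smul, dotProduct_smul, smul_eq_mul]
    ring
  have hh₂ : ∀ (x : DualSpace ι) (t : ℝ) (y : ι → ℝ),
      slackForm (t • y) x = t ^ 2 * slackForm y x := by
    intro x t y
    simp only [slackForm, LinearMap.coe_mk, AddHom.coe_mk,
      smul_dotProduct, mulVec_smul, dotProduct_smul, smul_eq_mul]
    ring
  obtain ⟨T₁, hT₁⟩ := exists_nonneg_mul_add_of_homogeneous (hc₁ x₀) (hc₁ x) (hh₁ x₀) (hh₁ x)
    fun p hp => h₁ p.1 p.2 hp
  obtain ⟨T₂, hT₂⟩ := exists_nonneg_mul_add_of_homogeneous (hc₂ x₀) (hc₂ x) (hh₂ x₀) (hh₂ x) h₂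
  refine ⟨max T₁ T₂, fun w y => ?_, fun y => ?_⟩
  · rw [map_add, map_smul]
    exact hT₁ _ (le_max_left _ _) (w, y)
  · rw [map_add, map_smul]
    exact hT₂ _ (le_max_right _ _) y

lemma dualCost_nonneg_of_pos [DecidableEq ι] {G : Matrix ι ι ℝ} {b c : ι → ℝ} {g : ℝ}
    (hg : ∀ l, 0 ≤ l → ∀ (x : ι → ℝ) (r : ℝ), G *ᵥ x - r • c = l • x →
      2 * l * (b ⬝ᵥ x) ^ 2 ≤ g * r ^ 2) (hg0 : 0 ≤ g)
    {x : DualSpace ι} (hx : dualConstraint G c x = 0)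
    (h₁ : ∀ w y, (w, y) ≠ 0 → 0 < borderedForm w y x) (h₂ : ∀ y, y ≠ 0 → 0 < slackForm y x) :
    0 ≤ dualCost b g x := by
  obtain ⟨z, v, V, Y⟩ := x
  simp only [dualConstraint, LinearMap.coe_mk, AddHom.coe_mk, Prod.mk_eq_zero, sub_eq_zero] at hx
  obtain ⟨hY, hVs, hYs⟩ := hx
  simp only [borderedForm, slackForm, LinearMap.coe_mk, AddHom.coe_mk] at h₁ h₂
  refine dual_value_nonneg_of_posDef hg hg0 ?_ ?_ (v := v) (V := V) ?_ hY
  · refine PosDef.of_dotProduct_mulVec_pos (by simpa [IsHermitian] using hVs) fun {y} hy => ?_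
    simpa using h₁ 0 y (by simpa using hy)
  · exact (PosDef.of_dotProduct_mulVec_pos (by simpa [IsHermitian] using hYs)
      fun {y} hy => by simpa using h₂ y hy).posSemidef
  · intro y
    simpa using (h₁ 1 y (by simp)).le

/-- A certificate matrix exists as soon as the scalar bound holds along the curve of solutions of
`G v - r c = l v`, `l ≥ 0`. -/
lemma exists_certificate [DecidableEq ι] {G : Matrix ι ι ℝ} {b c : ι → ℝ} {g : ℝ}
    (hg : ∀ l, 0 ≤ l → ∀ (x : ι → ℝ) (r : ℝ), G *ᵥ x - r • c = l • x →
      2 * l * (b ⬝ᵥ x) ^ 2 ≤ g * r ^ 2) (hg0 : 0 ≤ g)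
    (hspan : ∀ (a : ℝ) (y : ι → ℝ),
      (∀ l : ℝ, 0 < l → ∀ v : ι → ℝ, G *ᵥ v - c = l • v → a + y ⬝ᵥ v = 0) → a = 0 ∧ y = 0) :
    ∃ W : Matrix ι ι ℝ, (∀ (w : ℝ) (v : ι → ℝ), 0 ≤ g * w ^ 2 + 2 * (v ⬝ᵥ W *ᵥ (w • c - G *ᵥ v))) ∧
      ∀ y, (b ⬝ᵥ y) ^ 2 ≤ y ⬝ᵥ W *ᵥ y := by
  obtain ⟨x₀, hx₀, hp₁, hp₂⟩ := exists_strictly_feasible hspan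
  set D := LinearMap.ker (dualConstraint G c) with hD
  obtain ⟨φ, hφ, hφ0⟩ := riesz_extension (dualCone ι) ⟨D, (dualCost b g).domRestrict D⟩ (by
      rintro ⟨x, hx⟩ hxs
      change 0 ≤ dualCost b g x
      refine le_of_forall_pos_le_add fun ε hε => ?_
      set K := |dualCost b g x₀| + 1 with hK
      have hKpos : 0 < K := by positivity
      have hδ : 0 < ε / K := by positivity
      have := dualCost_nonneg_of_pos (b := b) hg hg0 (x := x + (ε / K) • x₀)
        (by rw [map_add, map_smul, hx₀, smul_zero, add_zero]; exact hx)
        (fun w y h => by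
          rw [map_add, map_smul]
          exact add_pos_of_nonneg_of_pos (hxs.1 w y) (mul_pos hδ (hp₁ w y h)))
        (fun y h => by
          rw [map_add, map_smul]
          exact add_pos_of_nonneg_of_pos (hxs.2 y) (mul_pos hδ (hp₂ y h)))
      rw [map_add, map_smul, smul_eq_mul] at this
      have h1 : ε / K * dualCost b g x₀ ≤ ε / K * K :=
        mul_le_mul_of_nonneg_left ((le_abs_self _).trans (by linarith)) hδ.le
      rw [div_mul_cancel₀ _ hKpos.ne'] at h1
      linarith) (by
      intro y
      obtain ⟨t, ht⟩ := exists_dominating hp₁ hp₂ y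
      exact ⟨⟨t • x₀, D.smul_mem t hx₀⟩, ht⟩)
  have hmem : φ - dualCost b g ∈ D.dualAnnihilator := by
    rw [Submodule.mem_dualAnnihilator]
    intro x hx
    rw [LinearMap.sub_apply, sub_eq_zero]
    exact hφ ⟨x, hx⟩
  rw [hD, ← LinearMap.range_dualMap_eq_dualAnnihilator_ker] at hmem
  obtain ⟨h, hh⟩ := hmem
  have hval : ∀ x, φ x = dualCost b g x + h (dualConstraint G c x) := by
    intro x
    have := LinearMap.congr_fun hh x
    rw [LinearMap.dualMap_apply, LinearMap.sub_apply] at this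
    linarith
  set W : Matrix ι ι ℝ := Matrix.of fun i j => h (Matrix.single j i 1, 0, 0) / 2 with hW
  have hWv : ∀ u v : ι → ℝ, h (vecMulVec u v, 0, 0) = 2 * (v ⬝ᵥ W *ᵥ u) := by
    intro u v
    have : ((vecMulVec u v, 0, 0) : Matrix ι ι ℝ × Matrix ι ι ℝ × Matrix ι ι ℝ) =
        ∑ i, ∑ j, (u i * v j) • (Matrix.single i j 1, 0, 0) := by
      refine Prod.ext ?_ (Prod.ext ?_ ?_)
      · simp only [Prod.fst_sum, Prod.smul_fst]
        conv_lhs => rw [matrix_eq_sum_single (vecMulVec u v)]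
        simp [vecMulVec_apply]
      · simp [Prod.snd_sum]
      · simp [Prod.snd_sum]
    rw [this, map_sum]
    simp only [map_sum, map_smul, smul_eq_mul, dotProduct, mulVec, Finset.mul_sum, hW, of_apply]
    rw [Finset.sum_comm]
    refine Finset.sum_congr rfl fun i _ => Finset.sum_congr rfl fun j _ => ?_
    ring
  refine ⟨W, fun w v => ?_, fun y => ?_⟩
  · have h0 := hφ0 _ (rankOneDual_mem_dualCone w v le_rfl 0)
    have e1 : dualCost b g (rankOneDual w v 0 0) = g * w ^ 2 := by
      simp [dualCost, rankOneDual]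
    have e2 : dualConstraint G c (rankOneDual w v 0 0) =
        (vecMulVec (w • c - G *ᵥ v) v, 0, 0) := by
      simp [dualConstraint, rankOneDual, mul_vecMulVec, sub_vecMulVec,
        smul_vecMulVec, vecMulVec_smul]
    rwa [hval, e1, e2, hWv] at h0
  · have h0 := hφ0 _ (rankOneDual_mem_dualCone 0 0 zero_le_one y)
    have e1 : dualCost b g (rankOneDual 0 0 1 y) = - (2 * (b ⬝ᵥ y) ^ 2) := by
      simp [dualCost, rankOneDual, dotProduct_vecMulVec_mulVec, dotProduct_comm y b, sq]
    have e2 : dualConstraint G c (rankOneDual 0 0 1 y) = (vecMulVec y y, 0, 0) := by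
      simp [dualConstraint, rankOneDual]
    rw [hval, e1, e2, hWv] at h0
    linarith

end Duality

lemma isUnit_det_smul_one_sub {n : ℕ} {A : Matrix (Fin n) (Fin n) ℝ} (hA : IsHurwitz A) {p : ℝ}
    (hp : 0 ≤ p) : IsUnit (p • (1 : Matrix (Fin n) (Fin n) ℝ) - A).det := by
  have h : (p : ℂ) ∉ spectrum ℂ (A.map Complex.ofReal) := fun h => by
    have := hA _ h
    rw [Complex.ofReal_re] at this
    linarith
  rw [spectrum.notMem_iff, isUnit_iff_isUnit_det, isUnit_iff_ne_zero] at h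
  rw [isUnit_iff_ne_zero]
  intro h0
  apply h
  have : algebraMap ℂ (Matrix (Fin n) (Fin n) ℂ) p - A.map Complex.ofReal =
      (p • (1 : Matrix (Fin n) (Fin n) ℝ) - A).map Complex.ofRealHom := by
    ext i j
    simp [algebraMap_matrix_apply, one_apply, apply_ite]
  rw [this, ← RingHom.mapMatrix_apply, ← RingHom.map_det, h0, map_zero]

lemma eq_zero_of_forall_dotProduct_pow_mulVec {n : ℕ} {G : Matrix (Fin n) (Fin n) ℝ}
    {C : Matrix (Fin 1) (Fin n) ℝ}
    (h : (Matrix.of fun i (p : Fin n × Fin 1) => ((G ^ (p.1 : ℕ)) * Cᵀ) i p.2).rank = n)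
    {y : Fin n → ℝ} (hy : ∀ k : ℕ, y ⬝ᵥ (G ^ k) *ᵥ C 0 = 0) : y = 0 := by
  rw [← rank_transpose] at h
  set K := (Matrix.of fun i (p : Fin n × Fin 1) => ((G ^ (p.1 : ℕ)) * Cᵀ) i p.2)ᵀ with hK
  have hker : LinearMap.ker K.mulVecLin = ⊥ := by
    have := K.mulVecLin.finrank_range_add_finrank_ker
    rw [← Matrix.rank, h, Module.finrank_fin_fun] at this
    exact Submodule.finrank_eq_zero.1 (by omega)
  have hmem : y ∈ LinearMap.ker K.mulVecLin := by
    rw [LinearMap.mem_ker, mulVecLin_apply]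
    ext ⟨k, j⟩
    have := hy k
    rw [dotProduct_comm] at this
    rw [Pi.zero_apply, ← this]
    simp [mulVec, dotProduct, hK, Matrix.mul_apply, Fin.eq_zero j]
  rwa [hker, Submodule.mem_bot] at hmem

lemma eq_zero_of_continuousAt_of_forall_pos {h : ℝ → ℝ} (hc : ContinuousAt h 0)
    (hp : ∀ p, 0 < p → h p = 0) : h 0 = 0 := by
  have h1 : Filter.Tendsto h (nhdsWithin 0 (Set.Ioi 0)) (nhds (h 0)) :=
    hc.tendsto.mono_left nhdsWithin_le_nhds
  refine tendsto_nhds_unique h1 (tendsto_const_nhds.congr' ?_)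
  filter_upwards [self_mem_nhdsWithin] with p hpp
  exact (hp p hpp).symm

/-- The vector `(p I - A)⁻ᵀ c`. -/
noncomputable def resolventVec {n : ℕ} (A : Matrix (Fin n) (Fin n) ℝ) (c : Fin n → ℝ) (p : ℝ) :
    Fin n → ℝ :=
  ((p • (1 : Matrix (Fin n) (Fin n) ℝ) - A)⁻¹)ᵀ *ᵥ c

section Resolvent

variable {n : ℕ} {A : Matrix (Fin n) (Fin n) ℝ} {c : Fin n → ℝ}

lemma eq_resolventVec_iff {p : ℝ} (h : IsUnit (p • (1 : Matrix (Fin n) (Fin n) ℝ) - A).det)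
    {x : Fin n → ℝ} : x = resolventVec A c p ↔ p • x - Aᵀ *ᵥ x = c := by
  have e : p • x - Aᵀ *ᵥ x = (p • (1 : Matrix (Fin n) (Fin n) ℝ) - A)ᵀ *ᵥ x := by
    simp [sub_mulVec, smul_mulVec]
  rw [e, resolventVec]
  constructor
  · rintro rfl
    rw [mulVec_mulVec, ← transpose_mul, nonsing_inv_mul _ h, transpose_one, one_mulVec]
  · rintro rfl
    rw [mulVec_mulVec, ← transpose_mul, mul_nonsing_inv _ h, transpose_one, one_mulVec]

lemma continuousAt_resolventVec (h : IsUnit A.det) : ContinuousAt (resolventVec A c) 0 := by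
  have hX : ContinuousAt (fun p : ℝ => (p • (1 : Matrix (Fin n) (Fin n) ℝ) - A)⁻¹) 0 := by
    have hc : Continuous fun p : ℝ => p • (1 : Matrix (Fin n) (Fin n) ℝ) - A := by fun_prop
    simp only [inv_def, Ring.inverse_eq_inv']
    refine ContinuousAt.smul (ContinuousAt.inv₀ hc.matrix_det.continuousAt ?_)
      hc.matrix_adjugate.continuousAt
    rw [zero_smul, zero_sub, det_neg]
    exact mul_ne_zero (pow_ne_zero _ (by norm_num)) h.ne_zero
  have hT : Continuous fun X : Matrix (Fin n) (Fin n) ℝ => Xᵀ *ᵥ c := by fun_prop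
  exact hT.continuousAt.comp hX

/-- Observability of `(A⁻ᵀ, c)` along the resolvent curve. -/
lemma eq_zero_of_forall_resolvent (hu : ∀ p : ℝ, 0 ≤ p →
      IsUnit (p • (1 : Matrix (Fin n) (Fin n) ℝ) - A).det)
    (hobs : ∀ y : Fin n → ℝ, (∀ k : ℕ, y ⬝ᵥ ((A⁻¹)ᵀ ^ k) *ᵥ c = 0) → y = 0)
    {a : ℝ} {y : Fin n → ℝ}
    (h : ∀ l : ℝ, 0 < l → ∀ v : Fin n → ℝ, (A⁻¹)ᵀ *ᵥ v - c = l • v → a + y ⬝ᵥ v = 0) :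
    a = 0 ∧ y = 0 := by
  have hAu : IsUnit A.det := by
    have := hu 0 le_rfl
    rw [zero_smul, zero_sub, det_neg] at this
    exact isUnit_of_mul_isUnit_right this
  have hGA : (A⁻¹)ᵀ * Aᵀ = 1 := by rw [← transpose_mul, mul_nonsing_inv _ hAu, transpose_one]
  set q : ℝ → Fin n → ℝ := fun p => Aᵀ *ᵥ resolventVec A c p with hq
  have hres : ∀ p, 0 ≤ p → p • resolventVec A c p - q p = c := fun p hp =>
    (eq_resolventVec_iff (hu p hp)).1 rfl
  have hGq : ∀ p, (A⁻¹)ᵀ *ᵥ q p = resolventVec A c p := fun p => by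
    rw [hq]; simp only; rw [mulVec_mulVec, hGA, one_mulVec]
  have hcont : ∀ (M : Matrix (Fin n) (Fin n) ℝ) (y : Fin n → ℝ),
      ContinuousAt (fun p => y ⬝ᵥ M *ᵥ q p) 0 := by
    intro M y
    have hT : Continuous fun x : Fin n → ℝ => y ⬝ᵥ M *ᵥ Aᵀ *ᵥ x := by fun_prop
    exact hT.continuousAt.comp (continuousAt_resolventVec hAu)
  have hcurve : ∀ p, 0 < p → a + p * (y ⬝ᵥ q p) = 0 := by
    intro p hp
    have := h p⁻¹ (inv_pos.2 hp) (p • q p) (by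
      rw [mulVec_smul, hGq, smul_smul, inv_mul_cancel₀ hp.ne', one_smul, sub_eq_iff_eq_add,
        ← sub_eq_iff_eq_add', hres p hp.le])
    rwa [dotProduct_smul, smul_eq_mul] at this
  have ha : a = 0 := by
    have := eq_zero_of_continuousAt_of_forall_pos (h := fun p => a + p * (y ⬝ᵥ 1 *ᵥ q p))
      (continuousAt_const.add (continuousAt_id.mul (hcont 1 y)))
      fun p hp => by simpa using hcurve p hp
    simpa using this
  have hq0 : q 0 = -c := by
    have := hres 0 le_rfl
    rw [zero_smul, zero_sub] at this
    rw [← this, neg_neg]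
  have hlim : ∀ k : ℕ, (∀ p, 0 < p → y ⬝ᵥ ((A⁻¹)ᵀ ^ k) *ᵥ q p = 0) →
      y ⬝ᵥ ((A⁻¹)ᵀ ^ k) *ᵥ c = 0 := by
    intro k hk
    have := eq_zero_of_continuousAt_of_forall_pos (hcont ((A⁻¹)ᵀ ^ k) y) hk
    rwa [hq0, mulVec_neg, dotProduct_neg, neg_eq_zero] at this
  have hall : ∀ (k : ℕ) (p : ℝ), 0 < p → y ⬝ᵥ ((A⁻¹)ᵀ ^ k) *ᵥ q p = 0 := by
    intro k
    induction k with
    | zero =>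
      intro p hp
      have := hcurve p hp
      rw [ha, zero_add, mul_eq_zero, or_iff_right hp.ne'] at this
      simpa using this
    | succ k ih =>
      intro p hp
      have h1 : q p = p • (A⁻¹)ᵀ *ᵥ q p - c := by
        rw [hGq]
        exact (sub_eq_iff_eq_add.2 (sub_eq_iff_eq_add'.1 (hres p hp.le))).symm
      have h2 := ih p hp
      rw [h1, mulVec_sub, mulVec_smul, mulVec_mulVec, ← pow_succ, dotProduct_sub, hlim k ih,
        sub_zero, dotProduct_smul, smul_eq_mul, mul_eq_zero, or_iff_right hp.ne'] at h2
      exact h2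
  exact ⟨ha, hobs y fun k => hlim k (hall k)⟩

end Resolvent

section Relaxation

variable {n : ℕ} {A : Matrix (Fin n) (Fin n) ℝ} {B : Matrix (Fin n) (Fin 1) ℝ}
  {C : Matrix (Fin 1) (Fin n) ℝ}

lemma fOne_eq (p : ℝ) : fOne A B C p = 2 * p * (B.col 0 ⬝ᵥ resolventVec A (C 0) p) ^ 2 := by
  set X := (p • (1 : Matrix (Fin n) (Fin n) ℝ) - A)⁻¹ with hX
  have h1 : (C * X * (p • (B * Bᵀ)) * Xᵀ * Cᵀ) = p • ((C * X * B) * (C * X * B)ᵀ) := by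
    simp only [transpose_mul, Matrix.mul_assoc, Matrix.mul_smul, Matrix.smul_mul]
  have h2 : (C * X * B) 0 0 = B.col 0 ⬝ᵥ resolventVec A (C 0) p := by
    rw [resolventVec, ← hX, mulVec_transpose, dotProduct_comm, Matrix.mul_apply]
    rfl
  rw [fOne, ← hX, h1, Matrix.smul_apply, Matrix.mul_apply, Fin.sum_univ_one, transpose_apply, h2,
    smul_eq_mul]
  ring

lemma LOne_eq (γ : ℝ) (S : Matrix (Fin n) (Fin n) ℝ) :
    LOne A B C γ S = fromBlocks !![γ ^ 2]
      ((S + vecMulVec (A⁻¹ *ᵥ B.col 0) (A⁻¹ *ᵥ B.col 0)) * Cᵀ)ᵀ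
      ((S + vecMulVec (A⁻¹ *ᵥ B.col 0) (A⁻¹ *ᵥ B.col 0)) * Cᵀ)
      (-((S + vecMulVec (A⁻¹ *ᵥ B.col 0) (A⁻¹ *ᵥ B.col 0)) * (A⁻¹)ᵀ) -
        ((S + vecMulVec (A⁻¹ *ᵥ B.col 0) (A⁻¹ *ᵥ B.col 0)) * (A⁻¹)ᵀ)ᵀ) := by
  have hT : A⁻¹ * B * Bᵀ * (A⁻¹)ᵀ = vecMulVec (A⁻¹ *ᵥ B.col 0) (A⁻¹ *ᵥ B.col 0) := by
    rw [Matrix.mul_assoc, ← transpose_mul]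
    ext i j
    rw [Matrix.mul_apply, vecMulVec_apply]
    simp only [Finset.univ_unique, Fin.default_eq_zero, Finset.sum_singleton, transpose_apply]
    rfl
  rw [LOne]
  simp only [hT]
  set T := vecMulVec (A⁻¹ *ᵥ B.col 0) (A⁻¹ *ᵥ B.col 0) with hTd
  have hTt : Tᵀ = T := by rw [hTd, transpose_vecMulVec]
  congr 1
  · simp only [transpose_mul, transpose_transpose, transpose_add, Matrix.mul_add, Matrix.neg_mul]
    abel
  · simp only [transpose_neg, Matrix.mul_neg, Matrix.add_mul]
    abel
  · simp only [transpose_mul, transpose_transpose, transpose_add, Matrix.add_mul]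
    abel

lemma isHermitian_LOne (γ : ℝ) (S : Matrix (Fin n) (Fin n) ℝ) :
    (LOne A B C γ S).IsHermitian := by
  rw [LOne_eq, IsHermitian, conjTranspose_eq_transpose_of_trivial, fromBlocks_transpose]
  congr 1
  · ext i j; simp [Fin.eq_zero i, Fin.eq_zero j]
  · simp only [transpose_sub, transpose_neg, transpose_transpose]
    abel

lemma LOne_quadratic (γ : ℝ) (S : Matrix (Fin n) (Fin n) ℝ) (w : Fin 1 → ℝ) (v : Fin n → ℝ) :
    Sum.elim w v ⬝ᵥ LOne A B C γ S *ᵥ Sum.elim w v =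
      γ ^ 2 * w 0 ^ 2 + 2 * (v ⬝ᵥ (S + vecMulVec (A⁻¹ *ᵥ B.col 0) (A⁻¹ *ᵥ B.col 0)) *ᵥ
        (w 0 • C 0 - (A⁻¹)ᵀ *ᵥ v)) := by
  rw [LOne_eq]
  set W := S + vecMulVec (A⁻¹ *ᵥ B.col 0) (A⁻¹ *ᵥ B.col 0)
  have hw : Cᵀ *ᵥ w = w 0 • C 0 := by
    ext i
    simp [mulVec, dotProduct, mul_comm]
  have h1 : w ⬝ᵥ (!![γ ^ 2] : Matrix (Fin 1) (Fin 1) ℝ) *ᵥ w = γ ^ 2 * w 0 ^ 2 := by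
    simp [mulVec, dotProduct]
    ring
  have h2 : ∀ {m k : ℕ} (M : Matrix (Fin m) (Fin k) ℝ) (x : Fin m → ℝ) (y : Fin k → ℝ),
      y ⬝ᵥ Mᵀ *ᵥ x = x ⬝ᵥ M *ᵥ y := by
    intro m k M x y
    rw [mulVec_transpose, dotProduct_comm, ← dotProduct_mulVec]
  rw [fromBlocks_mulVec, sumElim_dotProduct_sumElim]
  simp only [Sum.elim_comp_inl, Sum.elim_comp_inr, dotProduct_add, sub_mulVec, neg_mulVec,
    dotProduct_sub, dotProduct_neg, h2, h1, ← mulVec_mulVec, hw, mulVec_sub]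
  ring

lemma posSemidef_LOne_iff (γ : ℝ) (S : Matrix (Fin n) (Fin n) ℝ) :
    (LOne A B C γ S).PosSemidef ↔ ∀ (w : ℝ) (v : Fin n → ℝ),
      0 ≤ γ ^ 2 * w ^ 2 + 2 * (v ⬝ᵥ (S + vecMulVec (A⁻¹ *ᵥ B.col 0) (A⁻¹ *ᵥ B.col 0)) *ᵥ
        (w • C 0 - (A⁻¹)ᵀ *ᵥ v)) := by
  constructor
  · intro h w v
    have := h.dotProduct_mulVec_nonneg (Sum.elim (fun _ => w) v)
    rwa [star_trivial, LOne_quadratic] at this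
  · intro h
    refine PosSemidef.of_dotProduct_mulVec_nonneg (isHermitian_LOne γ S) fun x => ?_
    have hx : x = Sum.elim (x ∘ Sum.inl) (x ∘ Sum.inr) := (Sum.elim_comp_inl_inr x).symm
    rw [hx, star_trivial, LOne_quadratic]
    exact h _ _

lemma posSemidef_add_transpose_iff (S : Matrix (Fin n) (Fin n) ℝ) (b : Fin n → ℝ) :
    (S + Sᵀ).PosSemidef ↔ ∀ y, (b ⬝ᵥ y) ^ 2 ≤ y ⬝ᵥ (S + vecMulVec b b) *ᵥ y := by
  have hq : ∀ y : Fin n → ℝ, y ⬝ᵥ (S + Sᵀ) *ᵥ y = 2 * (y ⬝ᵥ S *ᵥ y) := by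
    intro y
    rw [add_mulVec, dotProduct_add, mulVec_transpose, dotProduct_comm y (y ᵥ* S),
      ← dotProduct_mulVec]
    ring
  have hb : ∀ y, y ⬝ᵥ (S + vecMulVec b b) *ᵥ y = y ⬝ᵥ S *ᵥ y + (b ⬝ᵥ y) ^ 2 := by
    intro y
    rw [add_mulVec, dotProduct_add, dotProduct_vecMulVec_mulVec, dotProduct_comm y b]
    ring
  constructor
  · intro h y
    have := h.dotProduct_mulVec_nonneg y
    rw [star_trivial, hq] at this
    rw [hb]
    linarith
  · intro h
    refine PosSemidef.of_dotProduct_mulVec_nonneg ?_ fun y => ?_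
    · rw [IsHermitian, conjTranspose_eq_transpose_of_trivial, transpose_add, transpose_transpose,
        add_comm]
    · have := h y
      rw [hb] at this
      rw [star_trivial, hq]
      linarith

lemma dotProduct_inv_mulVec (b x : Fin n → ℝ) : (A⁻¹ *ᵥ b) ⬝ᵥ x = b ⬝ᵥ (A⁻¹)ᵀ *ᵥ x := by
  rw [mulVec_transpose, dotProduct_comm, dotProduct_mulVec, dotProduct_comm]

lemma fOne_le_of_feasible (hA : IsHurwitz A) {γ : ℝ} {S : Matrix (Fin n) (Fin n) ℝ}
    (hS : (S + Sᵀ).PosSemidef) (hL : (LOne A B C γ S).PosSemidef) {p : ℝ} (hp : 0 < p) :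
    fOne A B C p ≤ γ ^ 2 := by
  have hAu : IsUnit A.det := by
    have := isUnit_det_smul_one_sub hA le_rfl
    rw [zero_smul, zero_sub, det_neg] at this
    exact isUnit_of_mul_isUnit_right this
  have hGA : (A⁻¹)ᵀ * Aᵀ = 1 := by rw [← transpose_mul, mul_nonsing_inv _ hAu, transpose_one]
  set x := resolventVec A (C 0) p with hx
  have hres : p • x - Aᵀ *ᵥ x = C 0 := (eq_resolventVec_iff (isUnit_det_smul_one_sub hA hp.le)).1 hx
  set q := Aᵀ *ᵥ x with hq
  have hGq : (A⁻¹)ᵀ *ᵥ q = x := by rw [hq, mulVec_mulVec, hGA, one_mulVec]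
  have h1 := (posSemidef_LOne_iff γ S).1 hL 1 (p • q)
  have h2 := (posSemidef_add_transpose_iff S (A⁻¹ *ᵥ B.col 0)).1 hS q
  have e : (1 : ℝ) • C 0 - (A⁻¹)ᵀ *ᵥ (p • q) = -q := by
    rw [one_smul, mulVec_smul, hGq, ← hres]; abel
  rw [e, mulVec_neg, dotProduct_neg, smul_dotProduct, smul_eq_mul] at h1
  rw [dotProduct_inv_mulVec, hGq] at h2
  rw [fOne_eq, ← hx]
  nlinarith [mul_le_mul_of_nonneg_left h2 hp.le]

lemma exists_feasible_of_fOne_le (hA : IsHurwitz A)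
    (hctrb : (Matrix.of fun i (p : Fin n × Fin 1) =>
      ((((A⁻¹)ᵀ) ^ (p.1 : ℕ)) * Cᵀ) i p.2).rank = n) {γ : ℝ}
    (hf : ∀ p : ℝ, 0 < p → fOne A B C p ≤ γ ^ 2) :
    ∃ S : Matrix (Fin n) (Fin n) ℝ, (S + Sᵀ).PosSemidef ∧ (LOne A B C γ S).PosSemidef := by
  have hu : ∀ p : ℝ, 0 ≤ p → IsUnit (p • (1 : Matrix (Fin n) (Fin n) ℝ) - A).det :=
    fun p hp => isUnit_det_smul_one_sub hA hp
  have hAu : IsUnit A.det := by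
    have := hu 0 le_rfl
    rw [zero_smul, zero_sub, det_neg] at this
    exact isUnit_of_mul_isUnit_right this
  have hAG : Aᵀ * (A⁻¹)ᵀ = 1 := by rw [← transpose_mul, nonsing_inv_mul _ hAu, transpose_one]
  obtain ⟨W, hW₁, hW₂⟩ := exists_certificate (G := (A⁻¹)ᵀ) (b := A⁻¹ *ᵥ B.col 0) (c := C 0)
    (g := γ ^ 2) (fun l hl x r h => by
      rcases hl.eq_or_lt with rfl | hl
      · simp only [mul_zero, zero_mul]
        positivity
      set u := (A⁻¹)ᵀ *ᵥ x with hu'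
      have hAu' : Aᵀ *ᵥ u = x := by rw [hu', mulVec_mulVec, hAG, one_mulVec]
      have hur : u = (l⁻¹ * r) • resolventVec A (C 0) l⁻¹ := by
        have hx := (eq_resolventVec_iff (c := (l⁻¹ * r) • C 0) (x := u)
          (hu l⁻¹ (inv_pos.2 hl).le)).2 (by
            rw [hAu', mul_smul, sub_eq_iff_eq_add.1 h, smul_add, smul_smul, inv_mul_cancel₀ hl.ne',
              one_smul]
            abel)
        rw [hx, resolventVec, mulVec_smul, resolventVec]
      have hfl := hf l⁻¹ (inv_pos.2 hl)
      rw [fOne_eq] at hfl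
      rw [dotProduct_inv_mulVec, ← hu', hur, dotProduct_smul, smul_eq_mul]
      have := mul_le_mul_of_nonneg_right hfl (sq_nonneg r)
      refine le_of_eq_of_le ?_ this
      field_simp) (sq_nonneg γ)
    (fun a y h => eq_zero_of_forall_resolvent hu
      (fun y hy => eq_zero_of_forall_dotProduct_pow_mulVec hctrb hy) h)
  have hWS : W - vecMulVec (A⁻¹ *ᵥ B.col 0) (A⁻¹ *ᵥ B.col 0) +
      vecMulVec (A⁻¹ *ᵥ B.col 0) (A⁻¹ *ᵥ B.col 0) = W := sub_add_cancel _ _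
  refine ⟨W - vecMulVec (A⁻¹ *ᵥ B.col 0) (A⁻¹ *ᵥ B.col 0), ?_, ?_⟩
  · rw [posSemidef_add_transpose_iff _ (A⁻¹ *ᵥ B.col 0), hWS]
    exact hW₂
  · rw [posSemidef_LOne_iff, hWS]
    exact hW₁

end Relaxation

theorem stmt17 {n : ℕ}
    (A : Matrix (Fin n) (Fin n) ℝ) (B : Matrix (Fin n) (Fin 1) ℝ) (C : Matrix (Fin 1) (Fin n) ℝ)
    (hA : IsHurwitz A)
    -- A has no real eigenvalues
    (hnoreal : ∀ μ ∈ spectrum ℂ (A.map Complex.ofReal), μ.im ≠ 0)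
    -- the pair (A⁻ᵀ, Cᵀ) is controllable
    (hctrb : (Matrix.of fun i (p : Fin n × Fin 1) =>
      ((((A⁻¹)ᵀ) ^ (p.1 : ℕ)) * Cᵀ) i p.2).rank = n) :
    (∀ γ : ℝ,
      (∃ S : Matrix (Fin n) (Fin n) ℝ, (S + Sᵀ).PosSemidef ∧ (LOne A B C γ S).PosSemidef)
        ↔ (∀ p₁ : ℝ, 0 < p₁ → fOne A B C p₁ ≤ γ ^ 2)) ∧
    sInf {x : ℝ | ∃ γ : ℝ, ∃ S : Matrix (Fin n) (Fin n) ℝ,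
        (S + Sᵀ).PosSemidef ∧ (LOne A B C γ S).PosSemidef ∧ x = γ ^ 2}
      = sSup {x : ℝ | ∃ p₁ : ℝ, 0 < p₁ ∧ x = fOne A B C p₁} := by
  have hiff : ∀ γ : ℝ,
      (∃ S : Matrix (Fin n) (Fin n) ℝ, (S + Sᵀ).PosSemidef ∧ (LOne A B C γ S).PosSemidef)
        ↔ (∀ p₁ : ℝ, 0 < p₁ → fOne A B C p₁ ≤ γ ^ 2) := fun γ =>
    ⟨fun ⟨_, hS, hL⟩ _ hp => fOne_le_of_feasible hA hS hL hp,
      fun hf => exists_feasible_of_fOne_le hA hctrb hf⟩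
  refine ⟨hiff, ?_⟩
  set T : Set ℝ := {x : ℝ | ∃ p₁ : ℝ, 0 < p₁ ∧ x = fOne A B C p₁} with hT
  have hset : {x : ℝ | ∃ γ : ℝ, ∃ S : Matrix (Fin n) (Fin n) ℝ,
      (S + Sᵀ).PosSemidef ∧ (LOne A B C γ S).PosSemidef ∧ x = γ ^ 2} =
      {x | 0 ≤ x ∧ x ∈ upperBounds T} := by
    ext x
    constructor
    · rintro ⟨γ, S, hS, hL, rfl⟩
      refine ⟨sq_nonneg γ, ?_⟩
      rintro _ ⟨p, hp, rfl⟩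
      exact fOne_le_of_feasible hA hS hL hp
    · rintro ⟨hx, hxT⟩
      obtain ⟨S, hS, hL⟩ := (hiff √x).2 fun p hp => by
        rw [Real.sq_sqrt hx]
        exact hxT ⟨p, hp, rfl⟩
      exact ⟨√x, S, hS, hL, (Real.sq_sqrt hx).symm⟩
  rw [hset]
  have hTne : T.Nonempty := ⟨_, 1, one_pos, rfl⟩
  by_cases hbdd : BddAbove T
  · have hnonneg : 0 ≤ sSup T := Real.sSup_nonneg fun x ⟨p, hp, hx⟩ => by
      rw [hx, fOne_eq]
      positivity
    exact IsLeast.csInf_eq ⟨⟨hnonneg, fun x hx => le_csSup hbdd hx⟩,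
      fun x hx => csSup_le hTne hx.2⟩
  · have hempty : {x | 0 ≤ x ∧ x ∈ upperBounds T} = ∅ :=
      Set.eq_empty_of_forall_notMem fun x hx => hbdd ⟨x, hx.2⟩
    rw [hempty, Real.sInf_empty, Real.sSup_of_not_bddAbove hbdd]
end
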